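/- The structure 𝔅 has no near-unanimity polymorphism of arity k for any k with 3 ≤ k ≤ 2^{2^n}. -/

import Mathlib

/- The universe `B = {a₁, a₂, 0, 1, ..., n}` of size `n+3` is encoded as
`Fin (n+3)`, where `a₁` is encoded as `0`, `a₂` as `1`, and the element
`i ∈ {0, ..., n}` as `i+2`; this encoding is order-preserving for the order
`a₁ < a₂ < 0 < 1 < ⋯ < n`. -/

/-- Compatibility with a binary relation, given as a set of pairs. -/
def Compat2 {A : Type*} {k : ℕ} (t : (Fin k → A) → A) (S : Set (A × A)) : Prop :=
  ∀ u w : Fin k → A, (∀ j, (u j, w j) ∈ S) → (t u, t w) ∈ S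

/-- Compatibility with a unary relation `X`: `t` maps `X^k` into `X`. -/
def CompatUnary {A : Type*} {k : ℕ} (t : (Fin k → A) → A) (X : Set A) : Prop :=
  ∀ u : Fin k → A, (∀ j, u j ∈ X) → t u ∈ X

/-- An operation `t : A^k → A` is a near-unanimity (NU) operation if `k ≥ 3` and
any tuple whose coordinates all equal `x` except possibly one coordinate (with
value `y`) is mapped to the majority value `x`. -/
def IsNU {A : Type*} {k : ℕ} (t : (Fin k → A) → A) : Prop :=
  3 ≤ k ∧ ∀ (x y : A) (j : Fin k), t (Function.update (fun _ => x) j y) = x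

/-- The binary relation `R^i_j ⊆ B²` (for `i ∈ {0,…,n}`, `j ∈ {1,2}`):
`(({a₁,a₂,0,…,i-1} × {a₁,a₂,i}) \ {(a_j, i)}) ∪ {(l,l) : i+1 ≤ l ≤ n}`.
In the encoding: the first coordinate has value `≤ i+1`, the second has value `0`,
`1` or `i+2`, excluding the pair `(j-1, i+2)`; the diagonal pairs have value `≥ i+3`. -/
def Rb (n i j : ℕ) : Set (Fin (n + 3) × Fin (n + 3)) :=
  {p | (p.1.val ≤ i + 1 ∧ (p.2.val = 0 ∨ p.2.val = 1 ∨ p.2.val = i + 2) ∧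
          ¬(p.1.val = j - 1 ∧ p.2.val = i + 2)) ∨
        (p.1 = p.2 ∧ i + 3 ≤ p.1.val)}

/-- A polymorphism of the structure `𝔅 = (B; R¹₁, R¹₂, …, Rⁿ₁, Rⁿ₂, (X)_{∅ ≠ X ⊆ B})`:
an operation compatible with each `R^i_j` and with every nonempty unary relation. -/
def PolyB (n : ℕ) {k : ℕ} (t : (Fin k → Fin (n + 3)) → Fin (n + 3)) : Prop :=
  (∀ i ≤ n, ∀ j, (j = 1 ∨ j = 2) → Compat2 t (Rb n i j)) ∧
  (∀ X : Set (Fin (n + 3)), X.Nonempty → CompatUnary t X)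

/-- The relation `Rb` on natural-number codes, with `j = 0, 1` standing for `a₁, a₂`. -/
def CodeRel (i j p q : ℕ) : Prop :=
  (p ≤ i + 1 ∧ (q = 0 ∨ q = 1 ∨ q = i + 2) ∧ ¬(p = j ∧ q = i + 2)) ∨ (p = q ∧ i + 3 ≤ p)

/-- An operation on the codes of `a₁, a₂, 0, …, n - 1` that is conservative, preserves the
relations of levels below `n`, and never returns `a_j` when `a_j` occurs at most once. -/
structure AvoidsRare {ι : Type} (n : ℕ) (s : (ι → ℕ) → ℕ) : Prop where
  mem_range : ∀ x : ι → ℕ, (∀ l, x l < n + 2) → ∃ l, s x = x l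
  compat : ∀ i < n, ∀ j < 2, ∀ x y : ι → ℕ, (∀ l, x l < n + 2) → (∀ l, y l < n + 2) →
    (∀ l, CodeRel i j (x l) (y l)) → CodeRel i j (s x) (s y)
  ne_of_rare : ∀ j < 2, ∀ x : ι → ℕ, (∀ l, x l < n + 2) →
    (∃ l₀, ∀ l, l ≠ l₀ → x l ≠ j) → s x ≠ j

namespace AvoidsRare

variable {ι : Type} {n : ℕ}

theorem false_of_card_le_two [Fintype ι] {s : (ι → ℕ) → ℕ} (hs : AvoidsRare 0 s)
    (hc : Fintype.card ι ≤ 2) : False := by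
  classical
  obtain ⟨l₀, -⟩ := hs.mem_range (fun _ => 0) (fun _ => by norm_num)
  set x : ι → ℕ := fun l => if l = l₀ then 0 else 1 with hx
  have hlt : ∀ l, x l < 0 + 2 := fun l => by simp only [hx]; split_ifs <;> norm_num
  have h0 : s x ≠ 0 := hs.ne_of_rare 0 (by norm_num) x hlt ⟨l₀, fun l hl => by simp [hx, hl]⟩
  have h1 : s x ≠ 1 := by
    refine hs.ne_of_rare 1 (by norm_num) x hlt ?_
    by_cases h : ∃ l₁, l₁ ≠ l₀
    · obtain ⟨l₁, h₁⟩ := h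
      refine ⟨l₁, fun l hl => ?_⟩
      have : l = l₀ := by
        by_contra hne
        have := Finset.card_le_univ ({l, l₁, l₀} : Finset ι)
        rw [Finset.card_eq_three.2 ⟨l, l₁, l₀, hl, hne, h₁, rfl⟩] at this
        omega
      simp [hx, this]
    · push Not at h
      exact ⟨l₀, fun l hl => absurd (h l) hl⟩
  obtain ⟨l, hl⟩ := hs.mem_range x hlt
  have := hlt l
  omega

/-- Identifying the coordinates in each fibre of `f`. -/
theorem comp_fibers {κ : Type} {s : (ι → ℕ) → ℕ} (hs : AvoidsRare (n + 1) s) (f : ι → κ)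
    (hf : ∀ b, ∃ w : ι → ℕ, (∀ l, f l = b → w l < 2) ∧ (∀ l, f l ≠ b → w l = n + 2) ∧
      s w = n + 2) :
    AvoidsRare n (fun x : κ → ℕ => s (x ∘ f)) where
  mem_range x hx := by
    obtain ⟨l, hl⟩ := hs.mem_range (x ∘ f) (fun l => (hx (f l)).trans (by omega))
    exact ⟨f l, hl⟩
  compat i hi j hj x y hx hy h :=
    hs.compat i (by omega) j hj _ _ (fun l => (hx (f l)).trans (by omega))
      (fun l => (hy (f l)).trans (by omega)) (fun l => h (f l))
  ne_of_rare j hj x hx := by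
    rintro ⟨b, hb⟩ heq
    obtain ⟨w, hw, hw', hsw⟩ := hf b
    have key : CodeRel n j (s (x ∘ f)) (s w) := by
      refine hs.compat n (by omega) j hj _ _ (fun l => (hx (f l)).trans (by omega)) ?_ ?_
      · intro l
        by_cases h : f l = b
        · have := hw l h
          omega
        · have := hw' l h
          omega
      · intro l
        have := hx (f l)
        simp only [CodeRel, Function.comp_apply]
        by_cases h : f l = b
        · have := hw l h
          omega
        · have := hw' l h
          have := hb (f l) h
          omega
    simp only [CodeRel] at key
    omega

open Classical in
/-- Extension of a partial tuple by the constant `c`. -/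
noncomputable def extend (p : ι → Prop) (c : ℕ) (x : {l // p l} → ℕ) (l : ι) : ℕ :=
  if h : p l then x ⟨l, h⟩ else c

theorem extend_of_pos {p : ι → Prop} {c : ℕ} {x : {l // p l} → ℕ} {l : ι} (h : p l) :
    extend p c x l = x ⟨l, h⟩ := dif_pos h

theorem extend_of_neg {p : ι → Prop} {c : ℕ} {x : {l // p l} → ℕ} {l : ι} (h : ¬p l) :
    extend p c x l = c := dif_neg h

theorem extend_lt {p : ι → Prop} {c m : ℕ} {x : {l // p l} → ℕ} (hx : ∀ l, x l < m) (hc : c < m)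
    (l : ι) : extend p c x l < m := by
  by_cases h : p l
  · rw [extend_of_pos h]; exact hx _
  · rwa [extend_of_neg h]

theorem extend_rel {r : ℕ → ℕ → Prop} {p : ι → Prop} {c : ℕ} {x y : {l // p l} → ℕ}
    (h : ∀ l, r (x l) (y l)) (hc : r c c) (l : ι) : r (extend p c x l) (extend p c y l) := by
  by_cases hl : p l
  · rw [extend_of_pos hl, extend_of_pos hl]; exact h _
  · rwa [extend_of_neg hl, extend_of_neg hl]

/-- If the top value never wins against tuples of codes `0, 1` on `p`, it never wins against lower
values on `p`. -/
theorem extend_ne_top {s : (ι → ℕ) → ℕ} (hs : AvoidsRare (n + 1) s) {p : ι → Prop}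
    (hp : ∀ x : {l // p l} → ℕ, (∀ l, x l < 2) → s (extend p (n + 2) x) ≠ n + 2)
    (d : ℕ) (hd : d ≤ n) (x : {l // p l} → ℕ)
    (hx : ∀ l, x l < n + 2 ∧ (x l < 2 ∨ n + 2 ≤ x l + d)) :
    s (extend p (n + 2) x) ≠ n + 2 := by
  induction d generalizing x with
  | zero => exact hp x fun l => by have := hx l; omega
  | succ d ih =>
    set u : {l // p l} → ℕ := fun l => if x l = n + 1 - d then 0 else x l with hu
    have hu' : ∀ l, (x l = n + 1 - d ∧ u l = 0) ∨ (x l ≠ n + 1 - d ∧ u l = x l) := by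
      intro l
      by_cases h : x l = n + 1 - d <;> simp [hu, h]
    have hsu := ih (by omega) u fun l => by
      have := hx l
      have := hu' l
      omega
    have key := hs.compat (n - 1 - d) (by omega) 1 (by omega) (extend p (n + 2) u)
      (extend p (n + 2) x)
      (extend_lt (fun l => by have := hx l; have := hu' l; omega) (by omega))
      (extend_lt (fun l => by have := hx l; omega) (by omega))
      (extend_rel (r := CodeRel _ _) (fun l => by
        have := hx l
        have := hu' l
        simp only [CodeRel]
        omega) (Or.inr ⟨rfl, by omega⟩))
    simp only [CodeRel] at key
    omega

/-- Fixing the top value outside `p`. -/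
theorem restrict {s : (ι → ℕ) → ℕ} (hs : AvoidsRare (n + 1) s) {p : ι → Prop}
    (hp : ∀ x : {l // p l} → ℕ, (∀ l, x l < 2) → s (extend p (n + 2) x) ≠ n + 2) :
    AvoidsRare n (fun x : {l // p l} → ℕ => s (extend p (n + 2) x)) where
  mem_range x hx := by
    obtain ⟨l, hl⟩ := hs.mem_range (extend p (n + 2) x)
      (extend_lt (fun l => (hx l).trans (by omega)) (by omega))
    have hne := hs.extend_ne_top hp n le_rfl x fun l => ⟨hx l, by omega⟩
    by_cases h : p l
    · exact ⟨⟨l, h⟩, by rw [hl, extend_of_pos h]⟩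
    · exact absurd (hl.trans (extend_of_neg h)) hne
  compat i hi j hj x y hx hy h :=
    hs.compat i (by omega) j hj _ _
      (extend_lt (fun l => (hx l).trans (by omega)) (by omega))
      (extend_lt (fun l => (hy l).trans (by omega)) (by omega))
      (extend_rel (r := CodeRel i j) h (Or.inr ⟨rfl, by omega⟩))
  ne_of_rare j hj x hx := by
    rintro ⟨l₀, h₀⟩
    refine hs.ne_of_rare j hj _ (extend_lt (fun l => (hx l).trans (by omega)) (by omega))
      ⟨l₀, fun l hl => ?_⟩
    by_cases h : p l
    · rw [extend_of_pos h]
      exact h₀ _ fun he => hl (congrArg Subtype.val he)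
    · rw [extend_of_neg h]
      omega

theorem false_of_card_le [Fintype ι] {s : (ι → ℕ) → ℕ} (hs : AvoidsRare n s)
    (hc : Fintype.card ι ≤ 2 ^ 2 ^ n) : False := by
  classical
  induction n generalizing ι with
  | zero => exact hs.false_of_card_le_two (by simpa using hc)
  | succ n ih =>
    have hc' : Fintype.card ι ≤ Fintype.card (Fin (2 ^ 2 ^ n) × Fin (2 ^ 2 ^ n)) := by
      rw [Fintype.card_prod, Fintype.card_fin, ← pow_add, ← two_mul, ← pow_succ']
      exact hc
    obtain ⟨e⟩ := Function.Embedding.nonempty_of_card_le hc'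
    by_cases hf : ∀ b, ∃ w : ι → ℕ, (∀ l, (e l).1 = b → w l < 2) ∧
        (∀ l, (e l).1 ≠ b → w l = n + 2) ∧ s w = n + 2
    · exact ih (hs.comp_fibers (fun l => (e l).1) hf) (by simp)
    · push Not at hf
      obtain ⟨b, hb⟩ := hf
      refine ih (hs.restrict (p := fun l => (e l).1 = b) fun x hx => ?_) ?_
      · exact hb _ (fun l hl => (extend_of_pos (p := fun l => (e l).1 = b) hl).trans_lt (hx _))
          (fun l hl => extend_of_neg (p := fun l => (e l).1 = b) hl)
      · have hinj : Function.Injective (fun l : {l // (e l).1 = b} => (e l.1).2) :=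
          fun l l' h => Subtype.ext (e.injective (Prod.ext (l.2.trans l'.2.symm) h))
        simpa using Fintype.card_le_of_injective _ hinj

end AvoidsRare

theorem mem_Rb_iff_codeRel {n i j : ℕ} {p : Fin (n + 3) × Fin (n + 3)} :
    p ∈ Rb n i (j + 1) ↔ CodeRel i j p.1.val p.2.val := by
  simp only [Rb, CodeRel, Set.mem_ofPred_eq, Nat.add_sub_cancel, ← Fin.val_inj]

/-- The code of a NU polymorphism: values beyond `n + 2` are truncated. -/
theorem PolyB.avoidsRare {n k : ℕ} {t : (Fin k → Fin (n + 3)) → Fin (n + 3)} (ht : PolyB n t)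
    (hnu : IsNU t) :
    AvoidsRare n (fun x : Fin k → ℕ => (t fun l => Fin.ofNat (n + 3) (x l)).val) := by
  have hval : ∀ m < n + 2, (Fin.ofNat (n + 3) m).val = m := fun m hm =>
    Nat.mod_eq_of_lt (by omega)
  refine ⟨fun x hx => ?_, fun i hi j hj x y hx hy h => ?_, fun j hj x hx => ?_⟩
  · have : Nonempty (Fin k) := ⟨⟨0, by have := hnu.1; omega⟩⟩
    obtain ⟨l, hl⟩ := ht.2 (Set.range fun l => Fin.ofNat (n + 3) (x l)) (Set.range_nonempty _)
      (fun l => Fin.ofNat (n + 3) (x l)) (fun l => ⟨l, rfl⟩)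
    exact ⟨l, by rw [← hl]; exact hval _ (hx l)⟩
  · refine mem_Rb_iff_codeRel.1 (ht.1 i hi.le (j + 1) (by omega) _ _ fun l => ?_)
    rw [mem_Rb_iff_codeRel, hval _ (hx l), hval _ (hy l)]
    exact h l
  · rintro ⟨l₀, h₀⟩ heq
    have key := mem_Rb_iff_codeRel.1 (ht.1 n le_rfl (j + 1) (by omega)
      (fun l => Fin.ofNat (n + 3) (x l)) (Function.update (fun _ => Fin.last (n + 2)) l₀ 0)
      fun l => by
        rw [mem_Rb_iff_codeRel, hval _ (hx l)]
        have := hx l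
        by_cases h : l = l₀
        · subst h
          simp [CodeRel]
          omega
        · have := h₀ l h
          simp [CodeRel, h]
          omega)
    rw [hnu.2] at key
    simp only [CodeRel, Fin.val_last, heq, and_true, or_true, not_true, and_false,
      false_or] at key
    omega

/-- The structure `𝔅` has no NU polymorphism of arity `k` for any
`3 ≤ k ≤ 2^(2^n)`. -/
theorem stmt15 (n : ℕ) (k : ℕ) (hk3 : 3 ≤ k) (hk : k ≤ 2 ^ 2 ^ n) :
    ¬ ∃ t : (Fin k → Fin (n + 3)) → Fin (n + 3), PolyB n t ∧ IsNU t := by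
  rintro ⟨t, ht, hnu⟩
  exact (ht.avoidsRare hnu).false_of_card_le (by simpa using hk)
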